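/- Let Ω = [0,L₁] × [0,L₂] be a periodic domain divided into N equal closed squares Q₁,…,Q_N, each of side length l (so L₁ and L₂ are integer multiples of l and N l² = L₁L₂), and let x^j ∈ Q_j be arbitrary for j = 1,…,N. Then for every smooth function u : ℝ² → ℝ that is L₁-periodic in x₁ and L₂-periodic in x₂, ‖∇u‖² ≤ 2·68^{-1/2} N η(u)² + 68^{1/2} l² ‖Δu‖², where η(u) = max_{j=1,…,N} |u(x^j)|. -/

import Mathlib

open MeasureTheory Real

/-- First partial derivative of a function on `ℝ²`. -/
noncomputable def pd1 (f : ℝ × ℝ → ℝ) (p : ℝ × ℝ) : ℝ :=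
  deriv (fun s => f (s, p.2)) p.1

/-- Second partial derivative of a function on `ℝ²`. -/
noncomputable def pd2 (f : ℝ × ℝ → ℝ) (p : ℝ × ℝ) : ℝ :=
  deriv (fun s => f (p.1, s)) p.2

/-- The Laplacian `Δf = ∂₁²f + ∂₂²f`. -/
noncomputable def lap (f : ℝ × ℝ → ℝ) (p : ℝ × ℝ) : ℝ :=
  pd1 (pd1 f) p + pd2 (pd2 f) p

theorem hasDerivAt_pd1 {f : ℝ × ℝ → ℝ} (hf : ContDiff ℝ (⊤ : ℕ∞) f) (x y : ℝ) :
    HasDerivAt (fun s => f (s, y)) (pd1 f (x, y)) x := by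
  have hd : Differentiable ℝ (fun s : ℝ => f (s, y)) :=
    (hf.comp (by fun_prop : ContDiff ℝ (⊤ : ℕ∞) fun s : ℝ => (s, y))).differentiable (by simp)
  exact (hd x).hasDerivAt

theorem hasDerivAt_pd2 {f : ℝ × ℝ → ℝ} (hf : ContDiff ℝ (⊤ : ℕ∞) f) (x y : ℝ) :
    HasDerivAt (fun s => f (x, s)) (pd2 f (x, y)) y := by
  have hd : Differentiable ℝ (fun s : ℝ => f (x, s)) :=
    (hf.comp (by fun_prop : ContDiff ℝ (⊤ : ℕ∞) fun s : ℝ => (x, s))).differentiable (by simp)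
  exact (hd y).hasDerivAt

theorem pd1_eq_fderiv {f : ℝ × ℝ → ℝ} (hf : ContDiff ℝ (⊤ : ℕ∞) f) :
    pd1 f = fun p => fderiv ℝ f p (1, 0) := by
  funext p
  have h := (hf.differentiable (by simp) p).hasFDerivAt
  have h2 : HasDerivAt (fun s : ℝ => (s, p.2)) ((1 : ℝ), (0 : ℝ)) p.1 :=
    (hasDerivAt_id p.1).prodMk (hasDerivAt_const p.1 p.2)
  exact (HasFDerivAt.comp_hasDerivAt (x := p.1) (f := fun s : ℝ => (s, p.2)) h h2).deriv

theorem pd2_eq_fderiv {f : ℝ × ℝ → ℝ} (hf : ContDiff ℝ (⊤ : ℕ∞) f) :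
    pd2 f = fun p => fderiv ℝ f p (0, 1) := by
  funext p
  have h := (hf.differentiable (by simp) p).hasFDerivAt
  have h2 : HasDerivAt (fun s : ℝ => (p.1, s)) ((0 : ℝ), (1 : ℝ)) p.2 :=
    (hasDerivAt_const p.2 p.1).prodMk (hasDerivAt_id p.2)
  exact (HasFDerivAt.comp_hasDerivAt (x := p.2) (f := fun s : ℝ => (p.1, s)) h h2).deriv

theorem contDiff_pd1 {f : ℝ × ℝ → ℝ} (hf : ContDiff ℝ (⊤ : ℕ∞) f) :
    ContDiff ℝ (⊤ : ℕ∞) (pd1 f) := by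
  rw [pd1_eq_fderiv hf]
  exact (hf.fderiv_right (by simp)).clm_apply contDiff_const

theorem contDiff_pd2 {f : ℝ × ℝ → ℝ} (hf : ContDiff ℝ (⊤ : ℕ∞) f) :
    ContDiff ℝ (⊤ : ℕ∞) (pd2 f) := by
  rw [pd2_eq_fderiv hf]
  exact (hf.fderiv_right (by simp)).clm_apply contDiff_const

theorem pd1_pd2_comm {f : ℝ × ℝ → ℝ} (hf : ContDiff ℝ (⊤ : ℕ∞) f) :
    pd1 (pd2 f) = pd2 (pd1 f) := by
  rw [pd1_eq_fderiv (contDiff_pd2 hf), pd2_eq_fderiv (contDiff_pd1 hf), pd1_eq_fderiv hf,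
    pd2_eq_fderiv hf]
  funext p
  have hd : DifferentiableAt ℝ (fderiv ℝ f) p :=
    ((hf.fderiv_right (m := (⊤ : ℕ∞)) (by simp)).differentiable (by simp)) p
  have hs : IsSymmSndFDerivAt ℝ f p := hf.contDiffAt.isSymmSndFDerivAt (by
    simpa using WithTop.coe_le_coe.2 (le_top (a := (2 : ℕ∞))))
  rw [fderiv_clm_apply hd (by fun_prop), fderiv_clm_apply hd (by fun_prop)]
  simpa using hs.eq (1, 0) (0, 1)

theorem pd1_mul {f g : ℝ × ℝ → ℝ} (hf : ContDiff ℝ (⊤ : ℕ∞) f) (hg : ContDiff ℝ (⊤ : ℕ∞) g)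
    (p : ℝ × ℝ) : pd1 (fun q => f q * g q) p = pd1 f p * g p + f p * pd1 g p :=
  ((hasDerivAt_pd1 hf p.1 p.2).mul (hasDerivAt_pd1 hg p.1 p.2)).deriv

theorem pd2_mul {f g : ℝ × ℝ → ℝ} (hf : ContDiff ℝ (⊤ : ℕ∞) f) (hg : ContDiff ℝ (⊤ : ℕ∞) g)
    (p : ℝ × ℝ) : pd2 (fun q => f q * g q) p = pd2 f p * g p + f p * pd2 g p :=
  ((hasDerivAt_pd2 hf p.1 p.2).mul (hasDerivAt_pd2 hg p.1 p.2)).deriv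

theorem pd1_translate {f : ℝ × ℝ → ℝ} {a b : ℝ} (h : ∀ p : ℝ × ℝ, f (p.1 + a, p.2 + b) = f p)
    (p : ℝ × ℝ) : pd1 f (p.1 + a, p.2 + b) = pd1 f p := by
  have : (fun s => f (s, p.2)) = fun s => f (s + a, p.2 + b) := by
    funext s; exact (h (s, p.2)).symm
  simp only [pd1]
  rw [this]
  exact (deriv_comp_add_const (fun s => f (s, p.2 + b)) a p.1).symm

theorem pd2_translate {f : ℝ × ℝ → ℝ} {a b : ℝ} (h : ∀ p : ℝ × ℝ, f (p.1 + a, p.2 + b) = f p)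
    (p : ℝ × ℝ) : pd2 f (p.1 + a, p.2 + b) = pd2 f p := by
  have : (fun s => f (p.1, s)) = fun s => f (p.1 + a, s + b) := by
    funext s; exact (h (p.1, s)).symm
  simp only [pd2]
  rw [this]
  exact (deriv_comp_add_const (fun s => f (p.1 + a, s)) b p.2).symm

theorem setIntegral_rect_eq {f : ℝ × ℝ → ℝ} (hf : Continuous f) {a b c d : ℝ} (hab : a ≤ b)
    (hcd : c ≤ d) :
    ∫ p in Set.Icc a b ×ˢ Set.Icc c d, f p = ∫ x in a..b, ∫ y in c..d, f (x, y) := by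
  rw [Measure.volume_eq_prod, setIntegral_prod _ ?_]
  · simp only [intervalIntegral.integral_of_le hab, intervalIntegral.integral_of_le hcd,
      integral_Icc_eq_integral_Ioc]
  · exact hf.continuousOn.integrableOn_compact (isCompact_Icc.prod isCompact_Icc)

theorem intervalIntegral_swap_of_continuous {f : ℝ × ℝ → ℝ} (hf : Continuous f) {a b c d : ℝ}
    (hab : a ≤ b) (hcd : c ≤ d) :
    ∫ x in a..b, ∫ y in c..d, f (x, y) = ∫ y in c..d, ∫ x in a..b, f (x, y) := by
  simp only [intervalIntegral.integral_of_le hab, intervalIntegral.integral_of_le hcd]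
  refine integral_integral_swap ?_
  rw [Measure.prod_restrict, ← Measure.volume_eq_prod]
  exact (hf.continuousOn.integrableOn_compact (isCompact_Icc.prod isCompact_Icc)).mono_set
    (Set.prod_mono Set.Ioc_subset_Icc_self Set.Ioc_subset_Icc_self)

theorem setIntegral_rect_pd1_eq_zero {f : ℝ × ℝ → ℝ} (hf : ContDiff ℝ (⊤ : ℕ∞) f) {a b : ℝ}
    (ha : 0 ≤ a) (hb : 0 ≤ b) (h : ∀ p : ℝ × ℝ, f (p.1 + a, p.2) = f p) :
    ∫ p in Set.Icc (0 : ℝ) a ×ˢ Set.Icc (0 : ℝ) b, pd1 f p = 0 := by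
  have hc := (contDiff_pd1 hf).continuous
  rw [setIntegral_rect_eq hc ha hb, intervalIntegral_swap_of_continuous hc ha hb]
  have : ∀ y, ∫ x in (0 : ℝ)..a, pd1 f (x, y) = 0 := by
    intro y
    rw [intervalIntegral.integral_eq_sub_of_hasDerivAt (fun x _ => hasDerivAt_pd1 hf x y)
      ((by fun_prop : Continuous fun x => pd1 f (x, y)).intervalIntegrable _ _)]
    have := h (0, y)
    simp only [zero_add] at this
    rw [this, sub_self]
  simp [this]

theorem setIntegral_rect_pd2_eq_zero {f : ℝ × ℝ → ℝ} (hf : ContDiff ℝ (⊤ : ℕ∞) f) {a b : ℝ}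
    (ha : 0 ≤ a) (hb : 0 ≤ b) (h : ∀ p : ℝ × ℝ, f (p.1, p.2 + b) = f p) :
    ∫ p in Set.Icc (0 : ℝ) a ×ˢ Set.Icc (0 : ℝ) b, pd2 f p = 0 := by
  have hc := (contDiff_pd2 hf).continuous
  rw [setIntegral_rect_eq hc ha hb]
  have : ∀ x, ∫ y in (0 : ℝ)..b, pd2 f (x, y) = 0 := by
    intro x
    rw [intervalIntegral.integral_eq_sub_of_hasDerivAt (fun y _ => hasDerivAt_pd2 hf x y)
      ((by fun_prop : Continuous fun y => pd2 f (x, y)).intervalIntegrable _ _)]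
    have := h (x, 0)
    simp only [zero_add] at this
    rw [this, sub_self]
  simp [this]

theorem sq_intervalIntegral_le {g : ℝ → ℝ} (hg : Continuous g) {a b : ℝ} (hab : a ≤ b) :
    (∫ t in a..b, g t) ^ 2 ≤ (b - a) * ∫ t in a..b, g t ^ 2 := by
  rcases hab.eq_or_lt with rfl | hlt
  · simp
  have hpos : 0 < b - a := sub_pos.2 hlt
  set I := ∫ t in a..b, g t with hI
  have h0 : 0 ≤ ∫ t in a..b, ((b - a) * g t - I) ^ 2 :=
    intervalIntegral.integral_nonneg hab fun t _ => sq_nonneg _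
  have h1 : ∫ t in a..b, ((b - a) * g t - I) ^ 2 =
      (b - a) ^ 2 * (∫ t in a..b, g t ^ 2) - 2 * (b - a) * I * I + I ^ 2 * (b - a) := by
    have : ∀ t, ((b - a) * g t - I) ^ 2 =
        (b - a) ^ 2 * g t ^ 2 - 2 * (b - a) * I * g t + I ^ 2 := fun t => by ring
    simp only [this]
    rw [intervalIntegral.integral_add, intervalIntegral.integral_sub,
      intervalIntegral.integral_const_mul, intervalIntegral.integral_const_mul,
      intervalIntegral.integral_const, ← hI, smul_eq_mul]
    · ring
    all_goals exact Continuous.intervalIntegrable (by fun_prop) _ _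
  rw [h1] at h0
  have h2 : 0 ≤ (b - a) * ((b - a) * (∫ t in a..b, g t ^ 2) - I ^ 2) := by linarith
  linarith [nonneg_of_mul_nonneg_right h2 hpos]

theorem sq_sub_le_mul_integral_deriv_sq {f f' : ℝ → ℝ} (hf : ∀ t, HasDerivAt f (f' t) t)
    (hf' : Continuous f') {a l x y : ℝ} (hx : x ∈ Set.Icc a (a + l))
    (hy : y ∈ Set.Icc a (a + l)) :
    (f x - f y) ^ 2 ≤ l * ∫ t in a..(a + l), f' t ^ 2 := by
  wlog hyx : y ≤ x generalizing x y
  · rw [← neg_sub, neg_sq]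
    exact this hy hx (le_of_not_ge hyx)
  have hc2 : Continuous fun t => f' t ^ 2 := by fun_prop
  rw [← intervalIntegral.integral_eq_sub_of_hasDerivAt (fun t _ => hf t)
    (hf'.intervalIntegrable _ _)]
  have h1 : ∫ t in y..x, f' t ^ 2 ≤ ∫ t in a..(a + l), f' t ^ 2 :=
    intervalIntegral.integral_mono_interval hy.1 hyx hx.2
      (Filter.Eventually.of_forall fun t => sq_nonneg _) (hc2.intervalIntegrable _ _)
  have h2 : 0 ≤ ∫ t in y..x, f' t ^ 2 :=
    intervalIntegral.integral_nonneg hyx fun t _ => sq_nonneg _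
  have h3 : x - y ≤ l := by linarith [hx.2, hy.1]
  exact (sq_intervalIntegral_le hf' hyx).trans
    (mul_le_mul h3 h1 h2 (by linarith))

theorem mul_sq_le_integral_sq_add {f f' : ℝ → ℝ} (hf : ∀ t, HasDerivAt f (f' t) t)
    (hf' : Continuous f') {a l x : ℝ} (hl : 0 ≤ l) (hx : x ∈ Set.Icc a (a + l)) :
    l * f x ^ 2 ≤ 2 * (∫ t in a..(a + l), f t ^ 2) +
      2 * l ^ 2 * ∫ t in a..(a + l), f' t ^ 2 := by
  have hc : Continuous f := continuous_iff_continuousAt.2 fun t => (hf t).continuousAt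
  have h : ∫ _t in a..(a + l), f x ^ 2 ≤
      ∫ t in a..(a + l), (2 * f t ^ 2 + 2 * (l * ∫ t in a..(a + l), f' t ^ 2)) := by
    refine intervalIntegral.integral_mono_on (by linarith)
      (Continuous.intervalIntegrable (by fun_prop) _ _)
      (Continuous.intervalIntegrable (by fun_prop) _ _) fun t ht => ?_
    have := sq_sub_le_mul_integral_deriv_sq hf hf' hx ht
    nlinarith [sq_nonneg (f x - 2 * f t)]
  rw [intervalIntegral.integral_add (Continuous.intervalIntegrable (by fun_prop) _ _)
    (Continuous.intervalIntegrable (by fun_prop) _ _), intervalIntegral.integral_const_mul,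
    intervalIntegral.integral_const, intervalIntegral.integral_const, smul_eq_mul,
    smul_eq_mul, add_sub_cancel_left] at h
  linarith

theorem integral_sq_square_le {u : ℝ × ℝ → ℝ} (hu : ContDiff ℝ (⊤ : ℕ∞) u) {a c l : ℝ}
    (hl : 0 ≤ l) {z : ℝ × ℝ} (hz : z ∈ Set.Icc a (a + l) ×ˢ Set.Icc c (c + l)) :
    ∫ y in c..(c + l), ∫ x in a..(a + l), u (x, y) ^ 2 ≤
      3 * l ^ 2 * u z ^ 2 + ∫ y in c..(c + l), ∫ x in a..(a + l),
        (3 * l ^ 2 * pd1 u (x, y) ^ 2 + 6 * l ^ 2 * pd2 u (x, y) ^ 2 +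
          6 * l ^ 4 * pd1 (pd2 u) (x, y) ^ 2) := by
  obtain ⟨z₁, z₂⟩ := z
  obtain ⟨hz₁, hz₂⟩ := hz
  have hu0 := hu.continuous
  have hu1 := (contDiff_pd1 hu).continuous
  have hu2 := (contDiff_pd2 hu).continuous
  have hu12 := (contDiff_pd1 (contDiff_pd2 hu)).continuous
  have hpar : ∀ f : ℝ × ℝ → ℝ, Continuous f →
      Continuous fun y => ∫ x in a..(a + l), f (x, y) := fun f hf =>
    intervalIntegral.continuous_parametric_intervalIntegral_of_continuous'
      (f := fun y x => f (x, y)) (by fun_prop) _ _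
  have c0 := hpar (fun p => u p ^ 2) (by fun_prop)
  have c1 := hpar (fun p => pd1 u p ^ 2) (by fun_prop)
  have c2 := hpar (fun p => pd2 u p ^ 2) (by fun_prop)
  have c12 := hpar (fun p => pd1 (pd2 u) p ^ 2) (by fun_prop)
  set K := ∫ s in c..(c + l), pd2 u (z₁, s) ^ 2 with hK
  have hrow : ∀ y ∈ Set.Icc c (c + l), ∫ x in a..(a + l), u (x, y) ^ 2 ≤
      3 * l * u (z₁, z₂) ^ 2 + 3 * l ^ 2 * (∫ x in a..(a + l), pd1 u (x, y) ^ 2) +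
        3 * l ^ 2 * K := by
    intro y hy
    have h : ∫ x in a..(a + l), u (x, y) ^ 2 ≤ ∫ _x in a..(a + l),
        (3 * u (z₁, z₂) ^ 2 + 3 * (l * ∫ x in a..(a + l), pd1 u (x, y) ^ 2) +
          3 * (l * K)) := by
      refine intervalIntegral.integral_mono_on (by linarith)
        (Continuous.intervalIntegrable (by fun_prop) _ _)
        (Continuous.intervalIntegrable (by fun_prop) _ _) fun x hx => ?_
      have h1 := sq_sub_le_mul_integral_deriv_sq (fun t => hasDerivAt_pd1 hu t y)
        (by fun_prop) hx hz₁
      have h2 := sq_sub_le_mul_integral_deriv_sq (fun t => hasDerivAt_pd2 hu z₁ t)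
        (by fun_prop) hy hz₂
      rw [← hK] at h2
      nlinarith [sq_nonneg (u (x, y) - u (z₁, y) - (u (z₁, y) - u (z₁, z₂))),
        sq_nonneg (u (x, y) - u (z₁, y) - u (z₁, z₂)),
        sq_nonneg (u (z₁, y) - u (z₁, z₂) - u (z₁, z₂))]
    rw [intervalIntegral.integral_const, smul_eq_mul, add_sub_cancel_left] at h
    linarith
  have hK_le : l * K ≤ 2 * (∫ y in c..(c + l), ∫ x in a..(a + l), pd2 u (x, y) ^ 2) +
      2 * l ^ 2 * ∫ y in c..(c + l), ∫ x in a..(a + l), pd1 (pd2 u) (x, y) ^ 2 := by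
    rw [hK, ← intervalIntegral.integral_const_mul, ← intervalIntegral.integral_const_mul,
      ← intervalIntegral.integral_const_mul, ← intervalIntegral.integral_add
        (Continuous.intervalIntegrable (by fun_prop) _ _)
        (Continuous.intervalIntegrable (by fun_prop) _ _)]
    refine intervalIntegral.integral_mono_on (by linarith)
      (Continuous.intervalIntegrable (by fun_prop) _ _)
      (Continuous.intervalIntegrable (by fun_prop) _ _) fun y hy => ?_
    exact mul_sq_le_integral_sq_add (fun t => hasDerivAt_pd1 (contDiff_pd2 hu) t y)
      (by fun_prop) hl hz₁
  have hsum := intervalIntegral.integral_mono_on (μ := volume) (by linarith : c ≤ c + l)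
    (c0.intervalIntegrable _ _)
    (Continuous.intervalIntegrable (by fun_prop) _ _) hrow
  rw [intervalIntegral.integral_add (Continuous.intervalIntegrable (by fun_prop) _ _)
    (Continuous.intervalIntegrable (by fun_prop) _ _),
    intervalIntegral.integral_add (Continuous.intervalIntegrable (by fun_prop) _ _)
    (Continuous.intervalIntegrable (by fun_prop) _ _)] at hsum
  simp only [intervalIntegral.integral_const_mul, intervalIntegral.integral_const, smul_eq_mul,
    add_sub_cancel_left] at hsum
  have hsplit : ∫ y in c..(c + l), ∫ x in a..(a + l),
        (3 * l ^ 2 * pd1 u (x, y) ^ 2 + 6 * l ^ 2 * pd2 u (x, y) ^ 2 +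
          6 * l ^ 4 * pd1 (pd2 u) (x, y) ^ 2) =
      3 * l ^ 2 * (∫ y in c..(c + l), ∫ x in a..(a + l), pd1 u (x, y) ^ 2) +
      6 * l ^ 2 * (∫ y in c..(c + l), ∫ x in a..(a + l), pd2 u (x, y) ^ 2) +
      6 * l ^ 4 * (∫ y in c..(c + l), ∫ x in a..(a + l), pd1 (pd2 u) (x, y) ^ 2) := by
    rw [← intervalIntegral.integral_const_mul, ← intervalIntegral.integral_const_mul,
      ← intervalIntegral.integral_const_mul, ← intervalIntegral.integral_add
        (Continuous.intervalIntegrable (by fun_prop) _ _)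
        (Continuous.intervalIntegrable (by fun_prop) _ _), ← intervalIntegral.integral_add
        (Continuous.intervalIntegrable (by fun_prop) _ _)
        (Continuous.intervalIntegrable (by fun_prop) _ _)]
    refine intervalIntegral.integral_congr fun y _ => ?_
    rw [intervalIntegral.integral_add (Continuous.intervalIntegrable (by fun_prop) _ _)
      (Continuous.intervalIntegrable (by fun_prop) _ _),
      intervalIntegral.integral_add (Continuous.intervalIntegrable (by fun_prop) _ _)
      (Continuous.intervalIntegrable (by fun_prop) _ _), intervalIntegral.integral_const_mul,
      intervalIntegral.integral_const_mul, intervalIntegral.integral_const_mul]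
  rw [hsplit]
  nlinarith [mul_le_mul_of_nonneg_left hK_le (by positivity : 0 ≤ 3 * l ^ 2)]

theorem setIntegral_rect_eq_sum {f : ℝ × ℝ → ℝ} (hf : Continuous f) {l : ℝ} (hl : 0 ≤ l)
    (n₁ n₂ : ℕ) :
    ∫ p in Set.Icc 0 (n₁ * l) ×ˢ Set.Icc 0 (n₂ * l), f p =
      ∑ j : Fin n₁ × Fin n₂, ∫ y in (j.2 * l : ℝ)..(j.2 * l + l),
        ∫ x in (j.1 * l : ℝ)..(j.1 * l + l), f (x, y) := by
  have hpar : ∀ a b : ℝ, Continuous fun y => ∫ x in a..b, f (x, y) := fun a b =>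
    intervalIntegral.continuous_parametric_intervalIntegral_of_continuous'
      (f := fun y x => f (x, y)) (by fun_prop) _ _
  have hsplit : ∀ (g : ℝ → ℝ), Continuous g → ∀ n : ℕ, ∫ x in (0 : ℝ)..(n * l), g x =
      ∑ i : Fin n, ∫ x in (i * l : ℝ)..(i * l + l), g x := by
    intro g hg n
    have := intervalIntegral.sum_integral_adjacent_intervals (μ := volume) (f := g)
      (a := fun k : ℕ => (k : ℝ) * l) (n := n) fun k _ => hg.intervalIntegrable _ _
    simp only [Nat.cast_zero, zero_mul, Nat.cast_add, Nat.cast_one, add_mul, one_mul] at this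
    rw [← this, Finset.sum_range]
  rw [setIntegral_rect_eq hf (by positivity) (by positivity),
    intervalIntegral_swap_of_continuous hf (by positivity) (by positivity),
    hsplit _ (hpar _ _), Fintype.sum_prod_type_right]
  refine Finset.sum_congr rfl fun j _ => ?_
  dsimp only
  rw [← intervalIntegral.integral_finsetSum fun i _ => (hpar _ _).intervalIntegrable _ _]
  exact intervalIntegral.integral_congr fun y _ => hsplit (fun x => f (x, y)) (by fun_prop) n₁

/-- `H¹` estimate via determining nodes: if the periodic domain
`Ω = [0,L₁] × [0,L₂]`, with `L₁ = n₁ l`, `L₂ = n₂ l`, is tiled by `N = n₁ n₂`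
equal squares of side `l` and a node `x j` is chosen in each square, then
`‖∇u‖² ≤ 2·68^{-1/2} N η(u)² + 68^{1/2} l² ‖Δu‖²`. -/
theorem nodes_H1_estimate
    (l : ℝ) (hl : 0 < l)
    (n₁ n₂ : ℕ) (hn₁ : 0 < n₁) (hn₂ : 0 < n₂)
    (L₁ L₂ : ℝ) (hL₁ : L₁ = (n₁ : ℝ) * l) (hL₂ : L₂ = (n₂ : ℝ) * l)
    (x : Fin n₁ × Fin n₂ → ℝ × ℝ)
    (hx : ∀ j : Fin n₁ × Fin n₂, x j ∈
      Set.Icc ((j.1 : ℝ) * l) (((j.1 : ℝ) + 1) * l) ×ˢ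
      Set.Icc ((j.2 : ℝ) * l) (((j.2 : ℝ) + 1) * l))
    (u : ℝ × ℝ → ℝ)
    (hsmooth : ContDiff ℝ (⊤ : ℕ∞) u)
    (hper1 : ∀ p : ℝ × ℝ, u (p.1 + L₁, p.2) = u p)
    (hper2 : ∀ p : ℝ × ℝ, u (p.1, p.2 + L₂) = u p) :
    (∫ p in Set.Icc (0 : ℝ) L₁ ×ˢ Set.Icc (0 : ℝ) L₂,
        ((pd1 u p) ^ 2 + (pd2 u p) ^ 2)) ≤
      2 * (68 : ℝ) ^ (-(1 : ℝ) / 2) * ((n₁ * n₂ : ℕ) : ℝ) *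
          (⨆ j : Fin n₁ × Fin n₂, |u (x j)|) ^ 2 +
      (68 : ℝ) ^ ((1 : ℝ) / 2) * l ^ 2 *
        ∫ p in Set.Icc (0 : ℝ) L₁ ×ˢ Set.Icc (0 : ℝ) L₂, (lap u p) ^ 2 := by
  have hL₁0 : 0 ≤ L₁ := hL₁ ▸ by positivity
  have hL₂0 : 0 ≤ L₂ := hL₂ ▸ by positivity
  have s1 := contDiff_pd1 hsmooth
  have s2 := contDiff_pd2 hsmooth
  have s11 := contDiff_pd1 s1
  have s12 := contDiff_pd1 s2
  have s22 := contDiff_pd2 s2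
  have c0 := hsmooth.continuous
  have c1 := s1.continuous
  have c2 := s2.continuous
  have c11 := s11.continuous
  have c12 := s12.continuous
  have c22 := s22.continuous
  have clap : Continuous (lap u) := c11.add c22
  set R := Set.Icc (0 : ℝ) L₁ ×ˢ Set.Icc (0 : ℝ) L₂ with hR
  have hfR : ∀ f : ℝ × ℝ → ℝ, Continuous f → IntegrableOn f R := fun f hf =>
    hf.continuousOn.integrableOn_compact (isCompact_Icc.prod isCompact_Icc)
  have hper1' : ∀ p : ℝ × ℝ, u (p.1 + L₁, p.2 + 0) = u p := by simpa using hper1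
  have hper2' : ∀ p : ℝ × ℝ, u (p.1 + 0, p.2 + L₂) = u p := by simpa using hper2
  set η := ⨆ j : Fin n₁ × Fin n₂, |u (x j)| with hη
  -- The identity `‖∇u‖² = -∫ u Δu`
  have green : ∫ p in R, ((pd1 u p) ^ 2 + (pd2 u p) ^ 2) = ∫ p in R, -(u p * lap u p) := by
    have h1 := setIntegral_rect_pd1_eq_zero (hsmooth.mul s1) hL₁0 hL₂0 fun p => by
      have := pd1_translate hper1' p
      simp only [add_zero] at this
      rw [hper1, this]
    have h2 := setIntegral_rect_pd2_eq_zero (hsmooth.mul s2) hL₁0 hL₂0 fun p => by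
      have := pd2_translate hper2' p
      simp only [add_zero] at this
      rw [hper2, this]
    simp only [pd1_mul hsmooth s1, pd2_mul hsmooth s2, ← hR] at h1 h2
    rw [← sub_eq_zero, ← integral_sub (hfR _ (by fun_prop)) (hfR _ (by fun_prop)),
      ← add_zero (0 : ℝ)]
    nth_rewrite 2 [← h1]
    rw [← h2, ← integral_add (hfR _ (by fun_prop)) (hfR _ (by fun_prop))]
    congr 1
    funext p
    simp only [lap]
    ring
  have mixed : ∫ p in R, pd1 (pd2 u) p ^ 2 = ∫ p in R, pd1 (pd1 u) p * pd2 (pd2 u) p := by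
    have h1 := setIntegral_rect_pd1_eq_zero (s2.mul s12) hL₁0 hL₂0 fun p => by
      have t2 := pd2_translate hper1'
      have t12 := pd1_translate t2 p
      have t2 := t2 p
      simp only [add_zero] at t2 t12
      rw [t2, t12]
    have h2 := setIntegral_rect_pd2_eq_zero (s2.mul s11) hL₁0 hL₂0 fun p => by
      have t2 := pd2_translate hper2' p
      have t11 := pd1_translate (pd1_translate hper2') p
      simp only [add_zero] at t2 t11
      rw [t2, t11]
    simp only [pd1_mul s2 s12, pd2_mul s2 s11, ← hR] at h1 h2
    have hcomm : pd2 (pd1 (pd1 u)) = pd1 (pd1 (pd2 u)) := by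
      rw [pd1_pd2_comm hsmooth, pd1_pd2_comm s1]
    rw [hcomm] at h2
    have c112 := (contDiff_pd1 s12).continuous
    rw [← sub_eq_zero, ← integral_sub (hfR _ (by fun_prop)) (hfR _ (by fun_prop)),
      ← sub_zero (0 : ℝ)]
    nth_rewrite 2 [← h2]
    rw [← h1, ← integral_sub (hfR _ (by fun_prop)) (hfR _ (by fun_prop))]
    congr 1
    funext p
    ring
  have mixed_le : 4 * ∫ p in R, pd1 (pd2 u) p ^ 2 ≤ ∫ p in R, lap u p ^ 2 := by
    rw [mixed, ← integral_const_mul]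
    refine integral_mono (hfR _ (by fun_prop)) (hfR _ (by fun_prop)) fun p => ?_
    simp only [lap]
    nlinarith [sq_nonneg (pd1 (pd1 u) p - pd2 (pd2 u) p)]
  have young : ∫ p in R, ((pd1 u p) ^ 2 + (pd2 u p) ^ 2) ≤
      1 / (20 * l ^ 2) * (∫ p in R, u p ^ 2) + 5 * l ^ 2 * ∫ p in R, lap u p ^ 2 := by
    rw [green, ← integral_const_mul, ← integral_const_mul,
      ← integral_add (hfR _ (by fun_prop)) (hfR _ (by fun_prop))]
    refine integral_mono (hfR _ (by fun_prop)) (hfR _ (by fun_prop)) fun p => ?_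
    have : 1 / (20 * l ^ 2) * u p ^ 2 + 5 * l ^ 2 * lap u p ^ 2 + u p * lap u p =
        1 / (20 * l ^ 2) * (u p + 10 * l ^ 2 * lap u p) ^ 2 := by
      field_simp
      ring
    have h0 : 0 ≤ 1 / (20 * l ^ 2) * (u p + 10 * l ^ 2 * lap u p) ^ 2 := by positivity
    simp only
    linarith
  have nodes : ∫ p in R, u p ^ 2 ≤ 3 * l ^ 2 * (((n₁ * n₂ : ℕ) : ℝ) * η ^ 2) +
      6 * l ^ 2 * (∫ p in R, ((pd1 u p) ^ 2 + (pd2 u p) ^ 2)) +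
        6 * l ^ 4 * ∫ p in R, pd1 (pd2 u) p ^ 2 := by
    have hmono : ∫ p in R, (3 * l ^ 2 * pd1 u p ^ 2 + 6 * l ^ 2 * pd2 u p ^ 2 +
          6 * l ^ 4 * pd1 (pd2 u) p ^ 2) ≤
        6 * l ^ 2 * (∫ p in R, ((pd1 u p) ^ 2 + (pd2 u p) ^ 2)) +
          6 * l ^ 4 * ∫ p in R, pd1 (pd2 u) p ^ 2 := by
      rw [← integral_const_mul, ← integral_const_mul,
        ← integral_add (hfR _ (by fun_prop)) (hfR _ (by fun_prop))]
      refine integral_mono (hfR _ (by fun_prop)) (hfR _ (by fun_prop)) fun p => ?_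
      have : 0 ≤ l ^ 2 * pd1 u p ^ 2 := by positivity
      simp only
      linarith
    have hle : ∫ p in R, u p ^ 2 ≤ 3 * l ^ 2 * (((n₁ * n₂ : ℕ) : ℝ) * η ^ 2) +
        ∫ p in R, (3 * l ^ 2 * pd1 u p ^ 2 + 6 * l ^ 2 * pd2 u p ^ 2 +
          6 * l ^ 4 * pd1 (pd2 u) p ^ 2) := by
      rw [hR, hL₁, hL₂, setIntegral_rect_eq_sum (by fun_prop) hl.le,
        setIntegral_rect_eq_sum (by fun_prop) hl.le]
      have hconst : 3 * l ^ 2 * (((n₁ * n₂ : ℕ) : ℝ) * η ^ 2) =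
          ∑ _j : Fin n₁ × Fin n₂, 3 * l ^ 2 * η ^ 2 := by
        simp only [Finset.sum_const, Finset.card_univ, Fintype.card_prod, Fintype.card_fin,
          nsmul_eq_mul]
        ring
      rw [hconst, ← Finset.sum_add_distrib]
      refine Finset.sum_le_sum fun j _ => ?_
      have hxj := hx j
      simp only [add_mul, one_mul] at hxj
      have hj : u (x j) ^ 2 ≤ η ^ 2 := by
        rw [← sq_abs]
        exact pow_le_pow_left₀ (abs_nonneg _) (le_ciSup (f := fun j => |u (x j)|)
          (Set.finite_range _).bddAbove j) 2
      refine (integral_sq_square_le hsmooth hl.le hxj).trans ?_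
      gcongr
    linarith
  have hD0 : 0 ≤ ∫ p in R, lap u p ^ 2 := integral_nonneg fun p => sq_nonneg _
  set G := ∫ p in R, ((pd1 u p) ^ 2 + (pd2 u p) ^ 2)
  set D := ∫ p in R, lap u p ^ 2
  set M := ∫ p in R, pd1 (pd2 u) p ^ 2
  set E := ((n₁ * n₂ : ℕ) : ℝ) * η ^ 2 with hE
  have hE0 : 0 ≤ E := by positivity
  have hG : G ≤ 3 / 14 * E + 29 / 4 * (l ^ 2 * D) := by
    have h1 : 1 / (20 * l ^ 2) * (∫ p in R, u p ^ 2) ≤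
        3 / 20 * E + 3 / 10 * G + 3 / 10 * (l ^ 2 * M) := by
      refine (mul_le_mul_of_nonneg_left nodes (by positivity)).trans_eq ?_
      field_simp
      ring
    have h2 := mul_le_mul_of_nonneg_left mixed_le (sq_nonneg l)
    linarith
  have hsqrt : (68 : ℝ) ^ ((1 : ℝ) / 2) = √68 := (Real.sqrt_eq_rpow 68).symm
  have hinv : (68 : ℝ) ^ (-(1 : ℝ) / 2) = √68 / 68 := by
    rw [neg_div, Real.rpow_neg (by norm_num), hsqrt]
    have h := Real.mul_self_sqrt (show (0 : ℝ) ≤ 68 by norm_num)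
    field_simp
    linarith
  have h8 : (8 : ℝ) ≤ √68 := Real.le_sqrt_of_sq_le (by norm_num)
  rw [hsqrt, hinv]
  have e1 : 3 / 14 * E ≤ 2 * (√68 / 68) * E := by gcongr; linarith
  have e2 : 29 / 4 * (l ^ 2 * D) ≤ √68 * (l ^ 2 * D) := by gcongr; linarith
  calc G ≤ 3 / 14 * E + 29 / 4 * (l ^ 2 * D) := hG
    _ ≤ 2 * (√68 / 68) * E + √68 * (l ^ 2 * D) := add_le_add e1 e2
    _ = _ := by rw [hE]; ring
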